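/- arXiv:1407.0539 — 2 statements merged into one kernel-verified Lean document; each statement's English description precedes it below -/
import Mathlib

section
/- Let {P₀, …, P_m} be a symmetric Clifford system on ℝ^{2l} and 2 ≤ i ≤ m. If x ∈ N_{i−1}, i.e. x ∈ S^{2l−1} with Σ_{α=0}^{i−1} ⟨P_αx, x⟩² = 1, then ⟨P_ix, x⟩ = 0, and for every t ∈ ℝ the point ψ_t(x) := (cos t)·x + (sin t)·P_ix belongs to N_i, i.e. |ψ_t(x)| = 1 and Σ_{α=0}^{i} ⟨P_α ψ_t(x), ψ_t(x)⟩² = 1; moreover ⟨P_i ψ_t(x), ψ_t(x)⟩ = sin 2t. (Thus the normal exponential map ψ_t sends N_{i−1} into the level set 𝒱_{sin 2t} of g_i in N_i.) -/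
open Matrix Real

/-- A symmetric matrix can be moved across the dot product. -/
theorem Matrix.IsSymm.mulVec_dotProduct {n : Type*} [Fintype n] {A : Matrix n n ℝ}
    (hA : A.IsSymm) (u w : n → ℝ) : A *ᵥ u ⬝ᵥ w = u ⬝ᵥ A *ᵥ w := by
  rw [dotProduct_mulVec, ← mulVec_transpose, hA.eq]

/-- The anticommutator of two symmetric matrices, read off in terms of dot products. -/
theorem Matrix.IsSymm.anticommutator_dotProduct {n : Type*} [Fintype n] {A B : Matrix n n ℝ}
    (hA : A.IsSymm) (hB : B.IsSymm) (u w : n → ℝ) :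
    A *ᵥ u ⬝ᵥ B *ᵥ w + B *ᵥ u ⬝ᵥ A *ᵥ w = u ⬝ᵥ (A * B + B * A) *ᵥ w := by
  rw [hA.mulVec_dotProduct, hB.mulVec_dotProduct, add_mulVec, dotProduct_add, mulVec_mulVec,
    mulVec_mulVec]

/-- A unit vector whose coefficients along an orthonormal family have square sum `1` is the
corresponding combination of that family. -/
theorem sum_dotProduct_smul_eq_of_sum_sq_eq_one {n ι : Type*} [Fintype n] [DecidableEq ι]
    (s : Finset ι) (e : ι → n → ℝ)
    (he : ∀ α ∈ s, ∀ β ∈ s, e α ⬝ᵥ e β = if α = β then 1 else 0)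
    (x : n → ℝ) (hx : x ⬝ᵥ x = 1) (hsum : ∑ α ∈ s, (e α ⬝ᵥ x) ^ 2 = 1) :
    ∑ α ∈ s, (e α ⬝ᵥ x) • e α = x := by
  set v := ∑ α ∈ s, (e α ⬝ᵥ x) • e α with hv
  have hvx : v ⬝ᵥ x = 1 := by
    rw [hv, sum_dotProduct, ← hsum]
    exact Finset.sum_congr rfl fun α _ => by rw [smul_dotProduct, smul_eq_mul, sq]
  have hev : ∀ α ∈ s, e α ⬝ᵥ v = e α ⬝ᵥ x := by
    intro α hα
    rw [hv, dotProduct_sum, Finset.sum_eq_single_of_mem α hα]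
    · rw [dotProduct_smul, he α hα α hα]; simp
    · intro β hβ hne
      rw [dotProduct_smul, he α hα β hβ, if_neg hne.symm, smul_zero]
  have hvv : v ⬝ᵥ v = 1 := by
    conv_lhs => rw [hv, sum_dotProduct]
    rw [← hsum]
    refine Finset.sum_congr rfl fun α hα => ?_
    rw [smul_dotProduct, ← hv, hev α hα, smul_eq_mul, sq]
  have hz : (v - x) ⬝ᵥ (v - x) = 0 := by
    rw [sub_dotProduct, dotProduct_sub, dotProduct_sub, hvv, hvx, dotProduct_comm x v, hvx, hx]
    ring
  exact sub_eq_zero.mp (dotProduct_self_eq_zero.mp hz)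

/-- For a symmetric Clifford system `{P₀, …, P_m}` on `ℝ^{2l}` and `2 ≤ i ≤ m`:
if `x ∈ N_{i-1}`, then `⟨P_i x, x⟩ = 0`, and for every `t ∈ ℝ` the point
`ψ_t(x) = (cos t) x + (sin t) P_i x` lies in `N_i`, with
`⟨P_i ψ_t(x), ψ_t(x)⟩ = sin 2t`. -/
theorem stmt_9 (l m i : ℕ) (hi2 : 2 ≤ i) (him : i ≤ m)
    (P : ℕ → Matrix (Fin (2 * l)) (Fin (2 * l)) ℝ)
    (hs : ∀ α ≤ m, (P α).IsSymm)
    (hc : ∀ α ≤ m, ∀ β ≤ m,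
      P α * P β + P β * P α = if α = β then (2 : ℝ) • 1 else 0)
    (x : Fin (2 * l) → ℝ) (hx : x ⬝ᵥ x = 1)
    (hxN : ∑ α ∈ Finset.range i, ((P α).mulVec x ⬝ᵥ x) ^ 2 = 1) :
    (P i).mulVec x ⬝ᵥ x = 0 ∧
    ∀ t : ℝ, ∀ y : Fin (2 * l) → ℝ,
      y = Real.cos t • x + Real.sin t • (P i).mulVec x →
      y ⬝ᵥ y = 1 ∧ (∑ α ∈ Finset.range (i + 1), ((P α).mulVec y ⬝ᵥ y) ^ 2 = 1) ∧
        (P i).mulVec y ⬝ᵥ y = Real.sin (2 * t) := by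
  have hself : ∀ α ≤ m, ∀ u w, P α *ᵥ u ⬝ᵥ P α *ᵥ w = u ⬝ᵥ w := by
    intro α hα u w
    have h := (hs α hα).anticommutator_dotProduct (hs α hα) u w
    rw [hc α hα α hα, if_pos rfl, smul_mulVec, one_mulVec, dotProduct_smul, smul_eq_mul] at h
    linarith
  have hanti : ∀ α ≤ m, ∀ β ≤ m, α ≠ β → ∀ u w,
      P α *ᵥ u ⬝ᵥ P β *ᵥ w = -(P β *ᵥ u ⬝ᵥ P α *ᵥ w) := by
    intro α hα β hβ hne u w
    have h := (hs α hα).anticommutator_dotProduct (hs β hβ) u w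
    rw [hc α hα β hβ, if_neg hne, zero_mulVec, dotProduct_zero] at h
    linarith
  have horth : ∀ α ≤ m, ∀ β ≤ m, α ≠ β → P α *ᵥ x ⬝ᵥ P β *ᵥ x = 0 := by
    intro α hα β hβ hne
    have h := hanti α hα β hβ hne x x
    rw [dotProduct_comm (P β *ᵥ x)] at h
    linarith
  have hle : ∀ α ∈ Finset.range i, α ≤ m ∧ α ≠ i := by
    intro α hα
    have := Finset.mem_range.mp hα
    omega
  have hxv : ∑ α ∈ Finset.range i, (P α *ᵥ x ⬝ᵥ x) • P α *ᵥ x = x := by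
    refine sum_dotProduct_smul_eq_of_sum_sq_eq_one (Finset.range i) (fun α => P α *ᵥ x) ?_ x hx hxN
    intro α hα β hβ
    split_ifs with h
    · subst h
      rw [hself α (hle α hα).1, hx]
    · exact horth α (hle α hα).1 β (hle β hβ).1 h
  have h0 : P i *ᵥ x ⬝ᵥ x = 0 := by
    rw [dotProduct_comm]
    conv_lhs => enter [1]; rw [← hxv]
    rw [sum_dotProduct]
    refine Finset.sum_eq_zero fun α hα => ?_
    rw [smul_dotProduct, horth α (hle α hα).1 i him (hle α hα).2, smul_zero]
  have h0' : x ⬝ᵥ P i *ᵥ x = 0 := by rw [dotProduct_comm, h0]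
  refine ⟨h0, ?_⟩
  rintro t y rfl
  have hquad : ∀ α ≤ m, P α *ᵥ (cos t • x + sin t • P i *ᵥ x) ⬝ᵥ (cos t • x + sin t • P i *ᵥ x) =
      cos t ^ 2 * (P α *ᵥ x ⬝ᵥ x) + 2 * sin t * cos t * (P α *ᵥ x ⬝ᵥ P i *ᵥ x) +
        sin t ^ 2 * (P α *ᵥ (P i *ᵥ x) ⬝ᵥ P i *ᵥ x) := by
    intro α hα
    have h : P α *ᵥ (P i *ᵥ x) ⬝ᵥ x = P α *ᵥ x ⬝ᵥ P i *ᵥ x := by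
      rw [(hs α hα).mulVec_dotProduct, dotProduct_comm]
    simp only [mulVec_add, mulVec_smul, add_dotProduct, dotProduct_add, smul_dotProduct,
      dotProduct_smul, smul_eq_mul, h]
    ring
  have hi : P i *ᵥ (cos t • x + sin t • P i *ᵥ x) ⬝ᵥ (cos t • x + sin t • P i *ᵥ x) =
      sin (2 * t) := by
    rw [hquad i him, hself i him, hself i him, h0, hx, sin_two_mul]
    ring
  refine ⟨?_, ?_, hi⟩
  · simp only [add_dotProduct, dotProduct_add, smul_dotProduct, dotProduct_smul, smul_eq_mul,
      hself i him, hx, h0, h0']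
    linear_combination sin_sq_add_cos_sq t
  · have hlt : ∀ α ∈ Finset.range i,
        (P α *ᵥ (cos t • x + sin t • P i *ᵥ x) ⬝ᵥ (cos t • x + sin t • P i *ᵥ x)) ^ 2 =
          cos (2 * t) ^ 2 * (P α *ᵥ x ⬝ᵥ x) ^ 2 := by
      intro α hα
      obtain ⟨hαm, hne⟩ := hle α hα
      rw [hquad α hαm, horth α hαm i him hne, hanti α hαm i him hne,
        (hs i him).mulVec_dotProduct (P i *ᵥ x), hself i him, dotProduct_comm x, cos_two_mul']
      ring
    rw [Finset.sum_range_succ, hi, Finset.sum_congr rfl hlt, ← Finset.mul_sum, hxN]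
    linear_combination sin_sq_add_cos_sq (2 * t)
end

section
/- Let {P₀, …, P_m} be a symmetric Clifford system on ℝ^{2l}, 2 ≤ i ≤ m, and let y ∈ S^{2l−1} satisfy P_iy = y and ⟨P_αy, y⟩ = 0 for all 0 ≤ α ≤ i−1. Then the fiber of the focal map ψ_{π/4}(x) = (x + P_ix)/√2 over y is given by {x ∈ N_{i−1} : x + P_ix = √2·y} = {(y + z)/√2 : z is a unit vector in the linear span of {P₀y, …, P_{i−1}y}}. In particular, this fiber is a round (i−1)-dimensional sphere of radius 1/√2. -/
open Matrix Real

/-- Symmetric matrices are self-adjoint for the dot product. -/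
lemma Matrix.IsSymm.mulVec_dotProduct_comm {n : Type*} [Fintype n] {A : Matrix n n ℝ}
    (hA : A.IsSymm) (u v : n → ℝ) : A *ᵥ u ⬝ᵥ v = u ⬝ᵥ A *ᵥ v := by
  rw [dotProduct_mulVec, ← mulVec_transpose, hA.eq]

lemma Matrix.isSymm_sum_smul {n ι : Type*} {P : ι → Matrix n n ℝ} {s : Finset ι}
    (hs : ∀ α ∈ s, (P α).IsSymm) (b : ι → ℝ) : (∑ α ∈ s, b α • P α).IsSymm := by
  unfold Matrix.IsSymm
  rw [transpose_sum]
  exact Finset.sum_congr rfl fun α hα => by rw [transpose_smul, (hs α hα).eq]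

/-- The Clifford relation between a linear combination of generators and a single generator
indexed in the summation range. -/
lemma clifford_mul_sum_add {n ι : Type*} [Fintype n] [DecidableEq n] [DecidableEq ι]
    {P : ι → Matrix n n ℝ} {s : Finset ι} {β : ι}
    (hc : ∀ α ∈ s, P β * P α + P α * P β = if β = α then (2 : ℝ) • 1 else 0) (b : ι → ℝ) :
    P β * (∑ α ∈ s, b α • P α) + (∑ α ∈ s, b α • P α) * P β =
      if β ∈ s then (2 * b β) • (1 : Matrix n n ℝ) else 0 := by
  rw [Finset.mul_sum, Finset.sum_mul, ← Finset.sum_add_distrib]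
  have h : ∀ α ∈ s, P β * (b α • P α) + b α • P α * P β =
      if β = α then (2 * b β) • (1 : Matrix n n ℝ) else 0 := by
    intro α hα
    rw [mul_smul_comm, smul_mul_assoc, ← smul_add, hc α hα]
    split_ifs with hβ
    · rw [smul_smul, hβ, mul_comm]
    · rw [smul_zero]
  rw [Finset.sum_congr rfl h, Finset.sum_ite_eq]

/-- A linear combination of Clifford generators squares to the sum of squares of its
coefficients. -/
lemma clifford_sum_mul_self {n ι : Type*} [Fintype n] [DecidableEq n] [DecidableEq ι]
    {P : ι → Matrix n n ℝ} {s : Finset ι}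
    (hc : ∀ α ∈ s, ∀ β ∈ s, P α * P β + P β * P α = if α = β then (2 : ℝ) • 1 else 0)
    (b : ι → ℝ) :
    (∑ α ∈ s, b α • P α) * (∑ α ∈ s, b α • P α) =
      (∑ α ∈ s, b α ^ 2) • (1 : Matrix n n ℝ) := by
  set Q := ∑ α ∈ s, b α • P α with hQ
  have h : Q * Q + Q * Q = (2 * ∑ α ∈ s, b α ^ 2) • (1 : Matrix n n ℝ) := by
    calc Q * Q + Q * Q = ∑ α ∈ s, b α • (P α * Q + Q * P α) := by
          simp only [smul_add, Finset.sum_add_distrib, ← smul_mul_assoc, ← Finset.sum_mul]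
          simp only [smul_mul_assoc, ← mul_smul_comm, ← Finset.mul_sum, ← hQ]
      _ = ∑ α ∈ s, (2 * b α ^ 2) • (1 : Matrix n n ℝ) := by
          refine Finset.sum_congr rfl fun α hα => ?_
          rw [hQ, clifford_mul_sum_add (hc α hα), if_pos hα, smul_smul]
          congr 1
          ring
      _ = _ := by rw [← Finset.sum_smul, Finset.mul_sum]
  rw [← two_smul ℝ, mul_smul] at h
  exact smul_right_injective _ (two_ne_zero (α := ℝ)) h

lemma sum_smul_mulVec {n ι : Type*} [Fintype n] (P : ι → Matrix n n ℝ) (s : Finset ι)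
    (b : ι → ℝ) (v : n → ℝ) :
    (∑ α ∈ s, b α • P α) *ᵥ v = ∑ α ∈ s, b α • (P α *ᵥ v) := by
  rw [sum_mulVec]
  exact Finset.sum_congr rfl fun α _ => smul_mulVec _ _ _

/-- For a symmetric Clifford system `{P₀, …, P_m}` on `ℝ^{2l}`, `2 ≤ i ≤ m`, and
`y ∈ S^{2l-1}` with `P_iy = y` and `⟨P_αy, y⟩ = 0` for `0 ≤ α ≤ i-1`, the fiber
of the focal map `ψ_{π/4}(x) = (x + P_ix)/√2` over `y` is
`{(y+z)/√2 : z a unit vector in span{P₀y, …, P_{i-1}y}}`. -/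
theorem stmt_12 (l m i : ℕ) (hi2 : 2 ≤ i) (him : i ≤ m)
    (P : ℕ → Matrix (Fin (2 * l)) (Fin (2 * l)) ℝ)
    (hs : ∀ α ≤ m, (P α).IsSymm)
    (hc : ∀ α ≤ m, ∀ β ≤ m,
      P α * P β + P β * P α = if α = β then (2 : ℝ) • 1 else 0)
    (y : Fin (2 * l) → ℝ) (hy : y ⬝ᵥ y = 1)
    (hy1 : (P i).mulVec y = y)
    (hy0 : ∀ α ≤ i - 1, (P α).mulVec y ⬝ᵥ y = 0) :
    {x : Fin (2 * l) → ℝ | x ⬝ᵥ x = 1 ∧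
        (∑ α ∈ Finset.range i, ((P α).mulVec x ⬝ᵥ x) ^ 2 = 1) ∧
        x + (P i).mulVec x = Real.sqrt 2 • y}
    = {w : Fin (2 * l) → ℝ | ∃ z : Fin (2 * l) → ℝ, z ⬝ᵥ z = 1 ∧
        z ∈ Submodule.span ℝ ((fun α => (P α).mulVec y) '' {α | α ≤ i - 1}) ∧
        w = (Real.sqrt 2)⁻¹ • (y + z)} := by
  have hset : {α | α ≤ i - 1} = (↑(Finset.range i) : Set ℕ) := by
    ext α
    simp only [Set.mem_ofPred_eq, Finset.coe_range, Set.mem_Iio]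
    omega
  have hsr : ∀ α ∈ Finset.range i, (P α).IsSymm := fun α hα =>
    hs α ((Finset.mem_range.mp hα).le.trans him)
  have hcr : ∀ α ∈ Finset.range i, ∀ β ∈ Finset.range i,
      P α * P β + P β * P α = if α = β then (2 : ℝ) • 1 else 0 := fun α hα β hβ =>
    hc α ((Finset.mem_range.mp hα).le.trans him) β ((Finset.mem_range.mp hβ).le.trans him)
  have hyr : ∀ α ∈ Finset.range i, P α *ᵥ y ⬝ᵥ y = 0 := fun α hα =>
    hy0 α (by have := Finset.mem_range.mp hα; omega)
  have hanti (b : ℕ → ℝ) (v : Fin (2 * l) → ℝ) :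
      P i *ᵥ (∑ α ∈ Finset.range i, b α • P α) *ᵥ v =
        -((∑ α ∈ Finset.range i, b α • P α) *ᵥ P i *ᵥ v) := by
    have h := clifford_mul_sum_add (s := Finset.range i)
      (fun α hα => hc i him α ((Finset.mem_range.mp hα).le.trans him)) b
    rw [if_neg Finset.notMem_range_self] at h
    rw [mulVec_mulVec, mulVec_mulVec, ← neg_mulVec, eq_neg_of_add_eq_zero_left h]
  have hsqr (b : ℕ → ℝ) (v : Fin (2 * l) → ℝ) :
      (∑ α ∈ Finset.range i, b α • P α) *ᵥ (∑ α ∈ Finset.range i, b α • P α) *ᵥ v =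
        (∑ α ∈ Finset.range i, b α ^ 2) • v := by
    rw [mulVec_mulVec, clifford_sum_mul_self hcr, smul_mulVec, one_mulVec]
  have hnorm (b : ℕ → ℝ) (v : Fin (2 * l) → ℝ) :
      (∑ α ∈ Finset.range i, b α • P α) *ᵥ v ⬝ᵥ (∑ α ∈ Finset.range i, b α • P α) *ᵥ v =
        (∑ α ∈ Finset.range i, b α ^ 2) * (v ⬝ᵥ v) := by
    rw [(isSymm_sum_smul hsr b).mulVec_dotProduct_comm, hsqr, dotProduct_smul, smul_eq_mul]
  have h2 : √2 * √2 = (2 : ℝ) := Real.mul_self_sqrt (by norm_num)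
  have h2' : (√2)⁻¹ * (√2)⁻¹ = (2 : ℝ)⁻¹ := by rw [← mul_inv, h2]
  have h20 : √2 ≠ (0 : ℝ) := by positivity
  rw [hset]
  ext x
  simp only [Set.mem_ofPred_eq]
  constructor
  · rintro ⟨hx, hN, hxy⟩
    set b : ℕ → ℝ := fun α => P α *ᵥ x ⬝ᵥ x
    set Q := ∑ α ∈ Finset.range i, b α • P α with hQ
    have hQx : Q *ᵥ x = x := by
      have h1 : Q *ᵥ x ⬝ᵥ x = 1 := by
        rw [hQ, sum_smul_mulVec, sum_dotProduct, ← hN]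
        exact Finset.sum_congr rfl fun α _ => by rw [smul_dotProduct, smul_eq_mul, sq]
      have h3 : Q *ᵥ x ⬝ᵥ Q *ᵥ x = 1 := by rw [hnorm, hx, mul_one]; exact hN
      rw [← sub_eq_zero, ← dotProduct_self_eq_zero, sub_dotProduct, dotProduct_sub,
        dotProduct_sub, h3, h1, dotProduct_comm, h1, hx]
      norm_num
    have hQy : √2 • Q *ᵥ y = x - P i *ᵥ x := by
      have h := hanti b x
      rw [← hQ, hQx] at h
      rw [← mulVec_smul, ← hxy, mulVec_add, hQx, sub_eq_add_neg, neg_eq_iff_eq_neg.mpr h]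
    refine ⟨Q *ᵥ y, ?_, ?_, ?_⟩
    · rw [hnorm, hy, mul_one]
      exact hN
    · rw [hQ, sum_smul_mulVec]
      exact Submodule.sum_smul_mem _ _ fun α hα =>
        Submodule.subset_span (Set.mem_image_of_mem _ (Finset.mem_coe.mpr hα))
    · have h : √2 • (y + Q *ᵥ y) = (2 : ℝ) • x := by
        rw [smul_add, hQy, ← hxy, two_smul]
        abel
      rw [eq_inv_smul_iff₀ h20]
      apply smul_right_injective _ h20
      simp only [smul_smul, h2, h]
  · rintro ⟨z, hz, hzs, rfl⟩
    rw [Submodule.mem_span_image_finset_iff_exists_fun'] at hzs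
    obtain ⟨b, hb⟩ := hzs
    rw [← sum_smul_mulVec] at hb
    set Q := ∑ α ∈ Finset.range i, b α • P α with hQ
    have hb1 : ∑ α ∈ Finset.range i, b α ^ 2 = 1 := by
      rw [← hz, ← hb, hnorm, hy, mul_one]
    have hzy : z ⬝ᵥ y = 0 := by
      rw [← hb, hQ, sum_smul_mulVec, sum_dotProduct]
      exact Finset.sum_eq_zero fun α hα => by rw [smul_dotProduct, hyr α hα, smul_zero]
    have hyz : y ⬝ᵥ z = 0 := by rw [dotProduct_comm, hzy]
    have hQz : Q *ᵥ z = y := by rw [← hb, hsqr, hb1, one_smul]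
    have hQs : Q.IsSymm := isSymm_sum_smul hsr b
    refine ⟨?_, ?_, ?_⟩
    · rw [smul_dotProduct, dotProduct_smul, smul_smul, h2', add_dotProduct, dotProduct_add,
        dotProduct_add, hy, hz, hzy, hyz]
      norm_num
    · rw [← hb1]
      refine Finset.sum_congr rfl fun α hα => ?_
      have hrel (v : Fin (2 * l) → ℝ) : P α *ᵥ Q *ᵥ v + Q *ᵥ P α *ᵥ v = (2 * b α) • v := by
        rw [mulVec_mulVec, mulVec_mulVec, ← add_mulVec, hQ,
          clifford_mul_sum_add (hcr α hα), if_pos hα, smul_mulVec, one_mulVec]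
      have hcross : P α *ᵥ y ⬝ᵥ z + P α *ᵥ z ⬝ᵥ y = 2 * b α := by
        have h := congrArg (· ⬝ᵥ y) (hrel y)
        simp only [add_dotProduct, smul_dotProduct, hy, hb, smul_eq_mul, mul_one,
          hQs.mulVec_dotProduct_comm] at h
        linarith
      have hzz : P α *ᵥ z ⬝ᵥ z = 0 := by
        have h := congrArg (· ⬝ᵥ z) (hrel y)
        simp only [add_dotProduct, smul_dotProduct, hyz, hb, smul_eq_mul, mul_zero,
          hQs.mulVec_dotProduct_comm, hQz, hyr α hα, add_zero] at h
        exact h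
      congr 1
      rw [mulVec_smul, smul_dotProduct, dotProduct_smul, smul_smul, h2', mulVec_add,
        add_dotProduct, dotProduct_add, dotProduct_add, hyr α hα, hzz, smul_eq_mul]
      linarith
    · have hPz : P i *ᵥ z = -z := by rw [← hb, hanti, hy1]
      rw [mulVec_smul, mulVec_add, hy1, hPz, ← smul_add, inv_smul_eq_iff₀ h20, smul_smul, h2,
        two_smul]
      abel
end
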